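/- arXiv:2109.14999 — 2 statements merged into one kernel-verified Lean document; each statement's English description precedes it below -/
import Mathlib

section
/- Let N ≥ 2 and let z_{1,N} > z_{2,N} > ... > z_{N,N} be the ordered roots of the Hermite polynomial H_N. Then Σ_{i,l : i ≠ l} 1/(z_{i,N} − z_{l,N})² = N(N−1)/2, where the sum runs over all ordered pairs (i,l) with i,l ∈ {1,...,N} and i ≠ l. -/
/-- The physicists' Hermite polynomials, orthogonal w.r.t. the weight `exp(-x²)` on `ℝ`:
`H_0 = 1`, `H_1 = 2X`, `H_{n+2} = 2X·H_{n+1} - 2(n+1)·H_n`. -/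
noncomputable def hermiteP : ℕ → Polynomial ℝ
  | 0 => 1
  | 1 => 2 * Polynomial.X
  | n + 2 => 2 * Polynomial.X * hermiteP (n + 1) - Polynomial.C (2 * ((n : ℝ) + 1)) * hermiteP n

open Polynomial

theorem hermiteP_add_two (n : ℕ) :
    hermiteP (n + 2) = 2 * X * hermiteP (n + 1) - C (2 * ((n : ℝ) + 1)) * hermiteP n := by
  rw [hermiteP]

theorem derivative_hermiteP_succ (n : ℕ) :
    derivative (hermiteP (n + 1)) = C (2 * ((n : ℝ) + 1)) * hermiteP n := by
  induction n using Nat.twoStepInduction with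
  | zero => simp [hermiteP, ← C_ofNat]
  | one => simp [hermiteP, ← C_ofNat]; ring_nf
  | more n ih1 ih2 =>
    rw [hermiteP_add_two (n + 1), derivative_sub, derivative_C_mul, derivative_mul, ih2, ih1,
      hermiteP_add_two n]
    simp only [derivative_mul, derivative_X, derivative_ofNat, map_mul, map_add, map_natCast,
      map_one, map_ofNat, Nat.cast_add, Nat.cast_one]
    push_cast
    ring

/-- The Hermite polynomials solve the Hermite differential equation. -/
theorem derivative_derivative_hermiteP (n : ℕ) :
    derivative (derivative (hermiteP n)) =
      2 * X * derivative (hermiteP n) - C (2 * (n : ℝ)) * hermiteP n := by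
  match n with
  | 0 => simp [hermiteP]
  | 1 => simp [hermiteP, ← C_ofNat]; ring
  | n + 2 =>
    rw [derivative_hermiteP_succ (n + 1), derivative_C_mul, derivative_hermiteP_succ n,
      hermiteP_add_two n]
    simp only [map_mul, map_add, map_natCast, map_one, map_ofNat]
    push_cast
    ring

theorem degree_and_leadingCoeff_hermiteP (n : ℕ) :
    (hermiteP n).degree = n ∧ (hermiteP n).leadingCoeff = 2 ^ n := by
  have h2X : (2 * X : ℝ[X]).degree = 1 ∧ (2 * X : ℝ[X]).leadingCoeff = 2 := by
    rw [← C_ofNat]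
    exact ⟨degree_C_mul_X (by norm_num), by simp⟩
  induction n using Nat.twoStepInduction with
  | zero => simp [hermiteP]
  | one => simpa [hermiteP] using h2X
  | more n ih1 ih2 =>
    have hdeg : (2 * X * hermiteP (n + 1)).degree = ((n + 2 : ℕ) : WithBot ℕ) := by
      rw [degree_mul, h2X.1, ih2.1]; norm_cast; ring
    have hlt : (C (2 * ((n : ℝ) + 1)) * hermiteP n).degree < (2 * X * hermiteP (n + 1)).degree := by
      rw [hdeg, degree_C_mul (by positivity), ih1.1]
      exact_mod_cast (by omega : n < n + 2)
    rw [hermiteP_add_two, degree_sub_eq_left_of_degree_lt hlt,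
      leadingCoeff_sub_of_degree_lt hlt, leadingCoeff_mul, h2X.2, ih2.2]
    exact ⟨hdeg, by ring⟩

theorem hermiteP_eq_C_mul_nodal {N : ℕ} {z : Fin N → ℝ} (hz : Function.Injective z)
    (hroot : ∀ i, (hermiteP N).eval (z i) = 0) :
    hermiteP N = C (2 ^ N) * Lagrange.nodal Finset.univ z := by
  obtain ⟨hdeg, hlc⟩ := degree_and_leadingCoeff_hermiteP N
  refine eq_of_degree_le_of_eval_index_eq Finset.univ hz.injOn (by simp [hdeg]) ?_ ?_ ?_
  · rw [degree_C_mul (by positivity), Lagrange.degree_nodal, hdeg]; simp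
  · rw [leadingCoeff_mul, leadingCoeff_C, Lagrange.nodal_monic.leadingCoeff, hlc, mul_one]
  · intro i hi
    rw [hroot, eval_mul, Lagrange.eval_nodal_at_node hi, mul_zero]

theorem eval_derivative_nodal_of_ne {ι F : Type*} [DecidableEq ι] [Field F] (s : Finset ι)
    (v : ι → F) {x : F} (hx : ∀ i ∈ s, x ≠ v i) :
    (derivative (Lagrange.nodal s v)).eval x =
      (Lagrange.nodal s v).eval x * ∑ i ∈ s, (x - v i)⁻¹ := by
  rw [Lagrange.derivative_nodal, eval_finsetSum, Finset.mul_sum]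
  refine Finset.sum_congr rfl fun i hi => ?_
  rw [Lagrange.nodal_eq_mul_nodal_erase hi, eval_mul]
  simp only [eval_sub, eval_X, eval_C]
  field_simp [sub_ne_zero.mpr (hx i hi)]

/-- The Stieltjes relation for the zeros of the Hermite polynomials. The summand `l = i` vanishes,
as `0⁻¹ = 0`. -/
theorem sum_inv_sub_hermiteP_roots {N : ℕ} {z : Fin N → ℝ} (hz : Function.Injective z)
    (hroot : ∀ i, (hermiteP N).eval (z i) = 0) (i : Fin N) :
    ∑ l, (z i - z l)⁻¹ = z i := by
  set Q := Lagrange.nodal (Finset.univ.erase i) z with hQ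
  have hne : ∀ l ∈ Finset.univ.erase i, z i ≠ z l := fun l hl h =>
    Finset.ne_of_mem_erase hl (hz h.symm)
  have hQ0 : Q.eval (z i) ≠ 0 := by
    rw [hQ, Lagrange.eval_nodal]
    exact Finset.prod_ne_zero_iff.mpr fun l hl => sub_ne_zero.mpr (hne l hl)
  have hfac : hermiteP N = C (2 ^ N) * ((X - C (z i)) * Q) := by
    rw [hermiteP_eq_C_mul_nodal hz hroot, Lagrange.nodal_eq_mul_nodal_erase (Finset.mem_univ i)]
  have hode := congrArg (eval (z i)) (derivative_derivative_hermiteP N)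
  rw [eval_sub, eval_mul (p := C _), hroot i, hfac] at hode
  simp only [derivative_mul, derivative_add, derivative_sub, derivative_C, derivative_X, eval_add,
    eval_mul, eval_sub, eval_C, eval_X, eval_ofNat, sub_self, zero_mul, mul_zero, zero_add,
    sub_zero, one_mul, add_zero] at hode
  have hQderiv := eval_derivative_nodal_of_ne (Finset.univ.erase i) z hne
  rw [← hQ] at hQderiv
  rw [hQderiv] at hode
  rw [← Finset.add_sum_erase _ _ (Finset.mem_univ i), sub_self, inv_zero, zero_add]
  have h2 : (2 : ℝ) ^ N * 2 * Q.eval (z i) ≠ 0 := by positivity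
  apply mul_left_cancel₀ h2
  linear_combination hode

theorem sum_sq_sum_inv_sub {ι F : Type*} [Fintype ι] [DecidableEq ι] [Field F] [CharZero F]
    {z : ι → F} (hz : Function.Injective z) :
    ∑ i, (∑ l, (z i - z l)⁻¹) ^ 2 = ∑ i, ∑ l, ((z i - z l) ^ 2)⁻¹ := by
  set f : ι → ι → F := fun i l => (z i - z l)⁻¹ with hf
  have hcyc (i l k : ι) : f i l * f i k + f l k * f l i + f k i * f k l =
      (if l = k then f i l ^ 2 else 0) + (if k = i then f l k ^ 2 else 0) +
        (if i = l then f k i ^ 2 else 0) := by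
    simp only [hf]
    by_cases h1 : l = k
    · subst h1
      by_cases h2 : l = i
      · simp [h2]
      · simp [h2, Ne.symm h2, -inv_pow]; ring
    by_cases h2 : k = i
    · subst h2
      simp [h1, Ne.symm h1, -inv_pow]; ring
    by_cases h3 : i = l
    · subst h3
      simp [h1, Ne.symm h1, -inv_pow]; ring
    have e1 := sub_ne_zero.mpr (hz.ne h1)
    have e2 := sub_ne_zero.mpr (hz.ne h2)
    have e3 := sub_ne_zero.mpr (hz.ne h3)
    rw [if_neg h1, if_neg h2, if_neg h3, ← neg_sub (z l) (z k), ← neg_sub (z i) (z l),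
      ← neg_sub (z k) (z i)]
    simp only [inv_neg]
    field_simp
    ring
  have hrot (g : ι → ι → ι → F) : ∑ i, ∑ l, ∑ k, g l k i = ∑ i, ∑ l, ∑ k, g i l k := by
    rw [Finset.sum_comm]
    exact Finset.sum_congr rfl fun i _ => Finset.sum_comm
  have hsum : ∑ i, ∑ l, ∑ k, (f i l * f i k + f l k * f l i + f k i * f k l) = ∑ i, ∑ l, ∑ k, _ :=
    Finset.sum_congr rfl fun i _ => Finset.sum_congr rfl fun l _ => Finset.sum_congr rfl
      fun k _ => hcyc i l k
  simp only [Finset.sum_add_distrib] at hsum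
  rw [hrot fun i l k => f i l * f i k, ← hrot fun i l k => f k i * f k l,
    hrot fun i l k => if l = k then f i l ^ 2 else 0,
    ← hrot fun i l k => if i = l then f k i ^ 2 else 0] at hsum
  have hleft : ∑ i, (∑ l, f i l) ^ 2 = ∑ i, ∑ l, ∑ k, f i l * f i k :=
    Finset.sum_congr rfl fun i _ => by rw [sq, Finset.sum_mul_sum]
  have hright : ∑ i, ∑ l, ((z i - z l) ^ 2)⁻¹ =
      ∑ i, ∑ l, ∑ k, if l = k then f i l ^ 2 else 0 := by
    simp [hf]
  rw [hleft, hright]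
  apply mul_left_cancel₀ (three_ne_zero (α := F))
  linear_combination hsum

theorem sum_mul_sum_inv_sub {ι F : Type*} [Fintype ι] [DecidableEq ι] [Field F] [CharZero F]
    {z : ι → F} (hz : Function.Injective z) :
    ∑ i, z i * ∑ l, (z i - z l)⁻¹ =
      (Fintype.card ι : F) * ((Fintype.card ι : F) - 1) / 2 := by
  have hpair (i l : ι) : z i * (z i - z l)⁻¹ + z l * (z l - z i)⁻¹ =
      1 - if i = l then 1 else 0 := by
    by_cases h : i = l
    · simp [h]
    · have e := sub_ne_zero.mpr (hz.ne h)
      rw [if_neg h, ← neg_sub (z i) (z l), inv_neg]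
      field_simp
      ring
  have hsum : ∑ i, ∑ l, (z i * (z i - z l)⁻¹ + z l * (z l - z i)⁻¹) =
      (Fintype.card ι : F) * ((Fintype.card ι : F) - 1) := by
    simp [hpair, mul_sub]
  simp only [Finset.sum_add_distrib] at hsum
  rw [Finset.sum_comm (f := fun i l => z l * (z l - z i)⁻¹)] at hsum
  simp only [Finset.mul_sum]
  linear_combination hsum / 2

/-- For the ordered roots `z 0 > z 1 > … > z (N-1)` of the Hermite
polynomial `H_N` (`N ≥ 2`),
`∑_{i ≠ l} 1/(z i - z l)² = N(N-1)/2` (sum over ordered pairs). -/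
theorem hermite_roots_square_sum_eq
    (N : ℕ) (hN : 2 ≤ N) (z : Fin N → ℝ) (hz : StrictAnti z)
    (hroot : ∀ i, (hermiteP N).eval (z i) = 0) :
    ∑ i, ∑ l ∈ Finset.univ.erase i, ((z i - z l) ^ 2)⁻¹
      = (N : ℝ) * ((N : ℝ) - 1) / 2 := by
  have herase : ∀ i, ∑ l ∈ Finset.univ.erase i, ((z i - z l) ^ 2)⁻¹ =
      ∑ l, ((z i - z l) ^ 2)⁻¹ := fun i => Finset.sum_erase _ (by simp)
  have hstieltjes := sum_inv_sub_hermiteP_roots hz.injective hroot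
  have hsq := sum_sq_sum_inv_sub hz.injective
  have hmul := sum_mul_sum_inv_sub hz.injective
  simp only [hstieltjes, Fintype.card_fin] at hsq hmul
  simp only [herase]
  rw [← hsq, ← hmul]
  simp only [sq]
end

section
/- Let ν > 0, N ≥ 2, and let z_{1,N} > ... > z_{N,N} > 0 be the ordered roots of the Laguerre polynomial L_N^{(ν−1)}. Then for every i ∈ {1,...,N−1}, sqrt(z_{i,N}) − sqrt(z_{i+1,N}) ≥ 1/sqrt(2N−1). -/
/-- The generalized Laguerre polynomials `L_n^{(a)}`, orthogonal w.r.t. the weight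
`exp(-x)·x^a` on `(0,∞)` (for `a > -1`), defined via the standard three-term recurrence
`L_0^{(a)} = 1`, `L_1^{(a)} = 1 + a - X`,
`(n+2)·L_{n+2}^{(a)} = (2(n+1)+1+a-X)·L_{n+1}^{(a)} - (n+1+a)·L_n^{(a)}`. -/
noncomputable def laguerreP (a : ℝ) : ℕ → Polynomial ℝ
  | 0 => 1
  | 1 => Polynomial.C (1 + a) - Polynomial.X
  | n + 2 =>
      Polynomial.C (1 / ((n : ℝ) + 2)) *
        ((Polynomial.C (2 * ((n : ℝ) + 1) + 1 + a) - Polynomial.X) * laguerreP a (n + 1)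
          - Polynomial.C (((n : ℝ) + 1) + a) * laguerreP a n)

open Polynomial in
theorem laguerreP_succ_succ (a : ℝ) (n : ℕ) :
    C ((n : ℝ) + 2) * laguerreP a (n + 2) =
      (C (2 * ((n : ℝ) + 1) + 1 + a) - X) * laguerreP a (n + 1)
        - C (((n : ℝ) + 1) + a) * laguerreP a n := by
  have h : (n : ℝ) + 2 ≠ 0 := by positivity
  rw [laguerreP, ← mul_assoc, ← C_mul, mul_one_div_cancel h, C_1, one_mul]

open Polynomial in
theorem laguerreP_derivative_aux (a : ℝ) (n : ℕ) :
    X * derivative (laguerreP a (n + 1)) =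
        C ((n : ℝ) + 1) * laguerreP a (n + 1) - C ((n : ℝ) + 1 + a) * laguerreP a n ∧
      derivative (laguerreP a (n + 1)) = derivative (laguerreP a n) - laguerreP a n := by
  induction n with
  | zero => simp [laguerreP]
  | succ n ih =>
    obtain ⟨hX, hsub⟩ := ih
    have hrec := laguerreP_succ_succ a n
    have hdrec := congrArg derivative hrec
    simp only [derivative_mul, derivative_sub, derivative_C, derivative_X, zero_mul, zero_add,
      zero_sub] at hdrec
    have hn : (C ((n : ℝ) + 2) : ℝ[X]) ≠ 0 := by
      rw [Ne, C_eq_zero]; positivity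
    have hsub' : derivative (laguerreP a (n + 2)) =
        derivative (laguerreP a (n + 1)) - laguerreP a (n + 1) := by
      apply mul_left_cancel₀ hn
      simp only [C_add, C_mul, C_1, C_ofNat] at *
      linear_combination hdrec - hX + (C (n : ℝ) + 1 + C a) * hsub
    refine ⟨?_, hsub'⟩
    push_cast
    simp only [C_add, C_mul, C_1, C_ofNat] at *
    linear_combination X * hsub' + hX - hrec

open Polynomial in
/-- The Laguerre differential equation. -/
theorem laguerreP_differential_equation (a : ℝ) (n : ℕ) :
    X * derivative (derivative (laguerreP a n)) + (C (1 + a) - X) * derivative (laguerreP a n)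
      + C (n : ℝ) * laguerreP a n = 0 := by
  cases n with
  | zero => simp [laguerreP]
  | succ n =>
    obtain ⟨hX, hsub⟩ := laguerreP_derivative_aux a n
    have hd := congrArg derivative hX
    simp only [derivative_mul, derivative_sub, derivative_C, derivative_X, zero_mul, zero_add,
      one_mul] at hd
    push_cast
    simp only [C_add, C_1] at *
    linear_combination hd - hX + (C (n : ℝ) + 1 + C a) * hsub

open Polynomial in
theorem natDegree_laguerreP_le (a : ℝ) (n : ℕ) : (laguerreP a n).natDegree ≤ n := by
  induction n using Nat.twoStepInduction with
  | zero => simp [laguerreP]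
  | one => rw [laguerreP]; compute_degree
  | more n h₀ h₁ =>
    rw [laguerreP]
    refine (natDegree_C_mul_le _ _).trans ((natDegree_sub_le _ _).trans (max_le ?_ ?_))
    · refine natDegree_mul_le.trans ?_
      have : (C (2 * ((n : ℝ) + 1) + 1 + a) - X : ℝ[X]).natDegree ≤ 1 := by compute_degree
      omega
    · exact (natDegree_C_mul_le _ _).trans (by omega)

open Polynomial in
theorem laguerreP_eval_zero_pos {a : ℝ} (ha : -1 < a) (n : ℕ) : 0 < (laguerreP a n).eval 0 := by
  induction n with
  | zero => simp [laguerreP]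
  | succ n ih =>
    have h := congrArg (eval 0) (laguerreP_derivative_aux a n).1
    simp only [eval_mul, eval_sub, eval_X, eval_C, zero_mul] at h
    have hn : (0 : ℝ) < n + 1 := by positivity
    have hna : 0 < (n : ℝ) + 1 + a := by linarith [n.cast_nonneg (α := ℝ)]
    exact pos_of_mul_pos_right (by linarith [mul_pos hna ih]) hn.le

open Polynomial in
theorem exists_eq_C_mul_prod_X_sub_C {N : ℕ} {p : ℝ[X]} (hp : p ≠ 0) (hdeg : p.natDegree ≤ N)
    {z : Fin N → ℝ} (hz : Function.Injective z) (hroot : ∀ i, p.eval (z i) = 0) :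
    ∃ c : ℝ, c ≠ 0 ∧ p = C c * ∏ i, (X - C (z i)) := by
  obtain ⟨q, hq⟩ : ∏ i, (X - C (z i)) ∣ p :=
    Finset.prod_dvd_of_coprime (fun i _ j _ hij => pairwise_coprime_X_sub_C hz hij)
      fun i _ => dvd_iff_isRoot.2 (hroot i)
  have hq0 : q ≠ 0 := by rintro rfl; simp at hq; exact hp hq
  have hmonic : (∏ i, (X - C (z i))).Monic := monic_prod_of_monic _ _ fun i _ => monic_X_sub_C _
  have hd : q.natDegree = 0 := by
    have h := congrArg natDegree hq
    rw [hmonic.natDegree_mul' hq0, natDegree_prod_of_monic _ _ fun i _ => monic_X_sub_C _] at h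
    simp at h
    omega
  rw [eq_C_of_natDegree_eq_zero hd] at hq hq0
  exact ⟨_, by simpa using hq0, by rw [hq, mul_comm]⟩

open Polynomial in
theorem eval_derivatives_prod_X_sub_C {ι : Type*} (s : Finset ι) (w : ι → ℝ) (x : ℝ)
    (hx : ∀ j ∈ s, x - w j ≠ 0) :
    (derivative (∏ j ∈ s, (X - C (w j)))).eval x =
        (∏ j ∈ s, (X - C (w j))).eval x * ∑ j ∈ s, 1 / (x - w j) ∧
      (derivative (derivative (∏ j ∈ s, (X - C (w j))))).eval x =
        (∏ j ∈ s, (X - C (w j))).eval x *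
          ((∑ j ∈ s, 1 / (x - w j)) ^ 2 - ∑ j ∈ s, 1 / (x - w j) ^ 2) := by
  classical
  induction s using Finset.induction_on with
  | empty => simp
  | insert k s hk ih =>
    obtain ⟨h₁, h₂⟩ := ih fun j hj => hx j (Finset.mem_insert_of_mem hj)
    have hxk := hx k (Finset.mem_insert_self k s)
    simp only [Finset.prod_insert hk, Finset.sum_insert hk, derivative_mul, derivative_add,
      derivative_sub, derivative_X, derivative_C, sub_zero, one_mul, eval_add, eval_mul, eval_sub,
      eval_X, eval_C, h₁, h₂]
    constructor
    · field_simp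
    · field_simp
      ring

open Polynomial in
/-- The Calogero-type sum over the roots of a Laguerre polynomial. -/
theorem laguerreP_roots_sum {ν : ℝ} (hν : 0 < ν) {N : ℕ} {z : Fin N → ℝ}
    (hz : Function.Injective z) (hpos : ∀ i, 0 < z i)
    (hroot : ∀ i, (laguerreP (ν - 1) N).eval (z i) = 0) (i : Fin N) :
    ∑ j ∈ Finset.univ.erase i, 2 * (z i + z j) / (z i - z j) ^ 2 =
      (z i - ν) * (1 + ν - z i) / (3 * z i) + 4 * ((N : ℝ) - 1) / 3 := by
  have hp : laguerreP (ν - 1) N ≠ 0 := by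
    intro h
    have := laguerreP_eval_zero_pos (a := ν - 1) (by linarith) N
    simp [h] at this
  obtain ⟨c, hc, hP⟩ :=
    exists_eq_C_mul_prod_X_sub_C hp (natDegree_laguerreP_le _ _) hz hroot
  have hne : ∀ j ∈ Finset.univ.erase i, z i - z j ≠ 0 := fun j hj =>
    sub_ne_zero.2 fun h => Finset.ne_of_mem_erase hj (hz h).symm
  obtain ⟨h₁, h₂⟩ := eval_derivatives_prod_X_sub_C _ z (z i) hne
  have hsum : ∑ j ∈ Finset.univ.erase i, 2 * (z i + z j) / (z i - z j) ^ 2 =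
      4 * z i * ∑ j ∈ Finset.univ.erase i, 1 / (z i - z j) ^ 2
        - 2 * ∑ j ∈ Finset.univ.erase i, 1 / (z i - z j) := by
    rw [Finset.mul_sum, Finset.mul_sum, ← Finset.sum_sub_distrib]
    refine Finset.sum_congr rfl fun j hj => ?_
    have := hne j hj
    field_simp
    ring
  have hR0 : (∏ j ∈ Finset.univ.erase i, (X - C (z j))).eval (z i) ≠ 0 := by
    rw [eval_prod, Finset.prod_ne_zero_iff]
    simpa using hne
  rw [← Finset.mul_prod_erase _ _ (Finset.mem_univ i)] at hP
  have hode := laguerreP_differential_equation (ν - 1) N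
  have hode' := congrArg derivative hode
  rw [hP] at hode hode'
  rw [hsum]
  generalize ∑ j ∈ Finset.univ.erase i, 1 / (z i - z j) ^ 2 = S₂ at *
  generalize ∑ j ∈ Finset.univ.erase i, 1 / (z i - z j) = S₁ at *
  generalize ∏ j ∈ Finset.univ.erase i, (X - C (z j)) = R at *
  have e₁ := congrArg (eval (z i)) hode
  have e₂ := congrArg (eval (z i)) hode'
  simp only [derivative_mul, derivative_add, derivative_sub, derivative_X, derivative_C,
    derivative_one, derivative_zero, eval_add, eval_mul, eval_sub, eval_X, eval_C, eval_one,
    eval_zero, h₁, h₂] at e₁ e₂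
  have hzi := hpos i
  have hcR := mul_ne_zero hc hR0
  have f₁ : 2 * z i * S₁ = z i - ν := by
    apply mul_left_cancel₀ hcR
    linear_combination e₁
  have f₂ : 3 * z i * (S₁ ^ 2 - S₂) + 2 * (1 + ν - z i) * S₁ + (N - 1) = 0 := by
    apply mul_left_cancel₀ hcR
    linear_combination e₂
  field_simp
  linear_combination (-4 * z i) * f₂ + (6 * z i * S₁ + (1 + ν - z i)) * f₁

/-- For the ordered roots `z 0 > … > z (N-1) > 0` of the Laguerre
polynomial `L_N^{(ν-1)}` (`ν > 0`, `N ≥ 2`), consecutive roots satisfy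
`√(z i) - √(z (i+1)) ≥ 1/√(2N-1)`. -/
theorem laguerre_roots_sqrt_gap_ge
    (ν : ℝ) (hν : 0 < ν) (N : ℕ) (hN : 2 ≤ N) (z : Fin N → ℝ)
    (hz : StrictAnti z) (hpos : ∀ i, 0 < z i)
    (hroot : ∀ i, (laguerreP (ν - 1) N).eval (z i) = 0) (i : ℕ) (hi : i + 1 < N) :
    Real.sqrt (z ⟨i, Nat.lt_of_succ_lt hi⟩) - Real.sqrt (z ⟨i + 1, hi⟩)
      ≥ 1 / Real.sqrt (2 * (N : ℝ) - 1) := by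
  set x := z ⟨i, Nat.lt_of_succ_lt hi⟩
  set y := z ⟨i + 1, hi⟩
  have hx0 : 0 < x := hpos _
  have hy0 : 0 < y := hpos _
  have hyx : y < x := hz (by simp [Fin.lt_def])
  have hN' : (2 : ℝ) ≤ N := by exact_mod_cast hN
  have hpair : 2 * (x + y) / (x - y) ^ 2 ≤ 2 * (N : ℝ) - 1 := by
    have hle := Finset.single_le_sum
      (f := fun j => 2 * (x + z j) / (x - z j) ^ 2)
      (s := Finset.univ.erase (⟨i, Nat.lt_of_succ_lt hi⟩ : Fin N))
      (fun j _ => by have := hpos j; positivity)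
      (a := ⟨i + 1, hi⟩) (by simp [Fin.ext_iff])
    refine hle.trans ((laguerreP_roots_sum hν hz.injective hpos hroot _).trans_le ?_)
    have : (x - ν) * (1 + ν - x) / (3 * x) ≤ 1 / 3 := by
      rw [div_le_div_iff₀ (by positivity) (by norm_num)]
      nlinarith [sq_nonneg (x - ν)]
    linarith
  obtain ⟨s, hs⟩ : ∃ s, s = √x := ⟨_, rfl⟩
  obtain ⟨t, ht⟩ : ∃ t, t = √y := ⟨_, rfl⟩
  have hs2 : x = s ^ 2 := by rw [hs, Real.sq_sqrt hx0.le]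
  have ht2 : y = t ^ 2 := by rw [ht, Real.sq_sqrt hy0.le]
  have ht0 : 0 < t := ht ▸ Real.sqrt_pos.2 hy0
  have hts : t < s := by rw [hs, ht]; exact Real.sqrt_lt_sqrt hy0.le hyx
  have hgap : 0 < s - t := sub_pos.2 hts
  have hM : 0 < 2 * (N : ℝ) - 1 := by linarith
  have hinv : 1 / (s - t) ^ 2 ≤ 2 * (N : ℝ) - 1 := by
    refine le_trans ?_ hpair
    have hst : 0 < s + t := by linarith
    have : 2 * (x + y) / (x - y) ^ 2 = 1 / (s - t) ^ 2 + 1 / (s + t) ^ 2 := by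
      rw [hs2, ht2, show s ^ 2 - t ^ 2 = (s - t) * (s + t) by ring]
      field_simp
      ring
    rw [this]
    exact le_add_of_nonneg_right (by positivity)
  rw [← hs, ← ht, ge_iff_le, one_div_le (Real.sqrt_pos.2 hM) hgap]
  apply Real.le_sqrt_of_sq_le
  rwa [div_pow, one_pow]
end
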